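/- For every integer d ≥ 1 there exists a constant B₂ > 0, depending only on d, such that for all p, q ∈ (1,∞) with p < q, setting α = d(1/p − 1/q), one has (1/B₂)·F(p,q) ≤ Ẽ_H(p,q,d) ≤ B₂·F(p,q). -/

import Mathlib

open Real

/-- The conjugate exponent `p' = p/(p-1)`. -/
noncomputable def conjExp (p : ℝ) : ℝ := p / (p - 1)

/-- `F(p,q) = (1/p' + 1/q)⁻¹ · (p q')⁻¹ · ( (p')^{1/q} + q^{1/p'} )`. -/
noncomputable def Fconst (p q : ℝ) : ℝ :=
  (1 / conjExp p + 1 / q)⁻¹ * (p * conjExp q)⁻¹ *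
    ((conjExp p) ^ (1 / q) + q ^ (1 / conjExp p))

/-- The surface measure of the unit sphere in `ℝ^d`: `ω_{d-1} = 2 π^{d/2} / Γ(d/2)`. -/
noncomputable def omegaSphere (d : ℕ) : ℝ :=
  2 * Real.pi ^ ((d : ℝ) / 2) / Real.Gamma ((d : ℝ) / 2)

/-- The best known bound `Ẽ_H(p,q,d)` for the homogeneous Sobolev embedding
constant on `ℝ^d`, with `α = d(1/p - 1/q)`. -/
noncomputable def EHtilde (d : ℕ) (p q : ℝ) : ℝ :=
  let α : ℝ := d * (1 / p - 1 / q)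
  (2 * Real.pi) ^ (-α) * (Real.Gamma (((d : ℝ) - α) / 2) / Real.Gamma (α / 2)) *
    ((d : ℝ) / α) * (omegaSphere d / d) ^ (1 - α / d) * (1 - α / d) ^ (1 - α / d) *
    (p * conjExp q)⁻¹ *
    ((conjExp p) ^ (1 / conjExp p + 1 / q) + q ^ (1 / conjExp p + 1 / q))

/-- The part of `EHtilde` that depends only on `d` and `t = 1/p' + 1/q` and stays bounded above
and away from `0`. -/
noncomputable def regularFactor (d : ℕ) (t : ℝ) : ℝ :=
  (2 * Real.pi) ^ (-((d : ℝ) * (1 - t))) *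
    (Real.Gamma ((d : ℝ) * t / 2 + 1) / Real.Gamma ((d : ℝ) * (1 - t) / 2 + 1)) *
    (omegaSphere d / d) ^ t

lemma omegaSphere_div_pos {d : ℕ} (hd : 1 ≤ d) : 0 < omegaSphere d / d := by
  have hd' : (0 : ℝ) < d := by exact_mod_cast hd
  have := Real.Gamma_pos_of_pos (half_pos hd')
  unfold omegaSphere
  positivity

lemma regularFactor_pos {d : ℕ} (hd : 1 ≤ d) {t : ℝ} (ht : t ∈ Set.Icc (0 : ℝ) 1) :
    0 < regularFactor d t := by
  have h0 := ht.1
  have h1 := sub_nonneg.2 ht.2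
  have hω := omegaSphere_div_pos hd
  have hΓ₁ : 0 < Real.Gamma ((d : ℝ) * t / 2 + 1) := Real.Gamma_pos_of_pos (by positivity)
  have hΓ₂ : 0 < Real.Gamma ((d : ℝ) * (1 - t) / 2 + 1) := Real.Gamma_pos_of_pos (by positivity)
  unfold regularFactor
  positivity

lemma continuousOn_regularFactor {d : ℕ} (hd : 1 ≤ d) :
    ContinuousOn (regularFactor d) (Set.Icc 0 1) := by
  intro t ht
  have h0 := ht.1
  have h1 := sub_nonneg.2 ht.2
  have hΓ : ∀ x : ℝ, 0 < x → ContinuousAt Real.Gamma x := fun x hx =>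
    (Real.differentiableAt_Gamma fun m => by
      have : (0 : ℝ) ≤ m := m.cast_nonneg
      linarith).continuousAt
  have hΓ₂ : 0 < Real.Gamma ((d : ℝ) * (1 - t) / 2 + 1) := Real.Gamma_pos_of_pos (by positivity)
  have c₁ : ContinuousAt (fun t : ℝ => Real.Gamma ((d : ℝ) * t / 2 + 1)) t :=
    ContinuousAt.comp (f := fun t : ℝ => (d : ℝ) * t / 2 + 1) (hΓ _ (by positivity))
      (by fun_prop)
  have c₂ : ContinuousAt (fun t : ℝ => Real.Gamma ((d : ℝ) * (1 - t) / 2 + 1)) t :=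
    ContinuousAt.comp (f := fun t : ℝ => (d : ℝ) * (1 - t) / 2 + 1) (hΓ _ (by positivity))
      (by fun_prop)
  refine ContinuousAt.continuousWithinAt ?_
  refine ((ContinuousAt.rpow continuousAt_const (by fun_prop) (Or.inl (by positivity))).mul
    (c₁.div c₂ hΓ₂.ne')).mul ?_
  exact ContinuousAt.rpow continuousAt_const continuousAt_id
    (Or.inl (omegaSphere_div_pos hd).ne')

lemma exists_bounds_regularFactor {d : ℕ} (hd : 1 ≤ d) :
    ∃ m M : ℝ, 0 < m ∧ ∀ t ∈ Set.Icc (0 : ℝ) 1,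
      m ≤ regularFactor d t ∧ regularFactor d t ≤ M := by
  have hne : (Set.Icc (0 : ℝ) 1).Nonempty := Set.nonempty_Icc.2 zero_le_one
  obtain ⟨x, hx, hmin⟩ := isCompact_Icc.exists_isMinOn hne (continuousOn_regularFactor hd)
  obtain ⟨y, -, hmax⟩ := isCompact_Icc.exists_isMaxOn hne (continuousOn_regularFactor hd)
  exact ⟨_, _, regularFactor_pos hd hx, fun t ht => ⟨hmin ht, hmax ht⟩⟩

lemma exp_neg_one_le_rpow_self {x : ℝ} (hx : 0 < x) : Real.exp (-1) ≤ x ^ x := by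
  rw [Real.rpow_def_of_pos hx, Real.exp_le_exp]
  have h := mul_le_mul_of_nonneg_right (Real.one_sub_inv_le_log_of_pos hx) hx.le
  rw [sub_mul, inv_mul_cancel₀ hx.ne'] at h
  linarith

/-- The sum `x^{-x-y} + y^{-x-y}` is comparable with `x^{-y} + y^{-x}`. -/
lemma inv_rpow_add_bounds {x y : ℝ} (hx : 0 < x) (hx1 : x ≤ 1) (hy : 0 < y) (hy1 : y ≤ 1) :
    x⁻¹ ^ y + y⁻¹ ^ x ≤ x⁻¹ ^ (x + y) + y⁻¹ ^ (x + y) ∧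
      x⁻¹ ^ (x + y) + y⁻¹ ^ (x + y) ≤ Real.exp 1 * (x⁻¹ ^ y + y⁻¹ ^ x) := by
  have key : ∀ z : ℝ, 0 < z → z ≤ 1 → 1 ≤ z⁻¹ ^ z ∧ z⁻¹ ^ z ≤ Real.exp 1 := by
    intro z hz hz1
    refine ⟨Real.one_le_rpow ((one_le_inv₀ hz).2 hz1) hz.le, ?_⟩
    rw [Real.inv_rpow hz.le]
    refine inv_le_of_inv_le₀ (Real.exp_pos 1) ?_
    rw [← Real.exp_neg]
    exact exp_neg_one_le_rpow_self hz
  rw [Real.rpow_add (inv_pos.2 hx), Real.rpow_add (inv_pos.2 hy)]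
  have hX : 0 < x⁻¹ ^ y := by positivity
  have hY : 0 < y⁻¹ ^ x := by positivity
  obtain ⟨a₁, a₂⟩ := key x hx hx1
  obtain ⟨b₁, b₂⟩ := key y hy hy1
  constructor
  · nlinarith
  · nlinarith

lemma EHtilde_eq {d : ℕ} (hd : 1 ≤ d) {p q : ℝ} (hp : 1 < p) (hq : 1 < q) (hpq : p < q) {t : ℝ}
    (ht : t = 1 / conjExp p + 1 / q) :
    EHtilde d p q = regularFactor d t * t ^ t * (t⁻¹ * (p * conjExp q)⁻¹ *
      (conjExp p ^ t + q ^ t)) := by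
  have hd' : (0 : ℝ) < d := by exact_mod_cast hd
  have hp0 : 0 < p := by linarith
  have hq0 : 0 < q := by linarith
  have hα : 1 / p - 1 / q = 1 - t := by
    rw [ht, conjExp]
    have : p - 1 ≠ 0 := by linarith
    field_simp
    ring
  have ht1 : 0 < 1 - t := by
    rw [← hα]
    exact sub_pos.2 (one_div_lt_one_div_of_lt hp0 hpq)
  have ht0 : 0 < t := by
    have h1 : 1 / p < 1 := (div_lt_one hp0).2 hp
    have h2 : 0 < 1 / q := by positivity
    linarith
  have e₁ : ((d : ℝ) - d * (1 - t)) / 2 = d * t / 2 := by ring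
  have e₂ : 1 - (d : ℝ) * (1 - t) / d = t := by field_simp; ring
  have g₁ : Real.Gamma (d * t / 2 + 1) = d * t / 2 * Real.Gamma (d * t / 2) :=
    Real.Gamma_add_one (by positivity)
  have g₂ : Real.Gamma (d * (1 - t) / 2 + 1) = d * (1 - t) / 2 * Real.Gamma (d * (1 - t) / 2) :=
    Real.Gamma_add_one (by positivity)
  have hΓ : 0 < Real.Gamma (d * (1 - t) / 2) := Real.Gamma_pos_of_pos (by positivity)
  simp only [EHtilde, regularFactor]
  rw [hα, ← ht, e₁, e₂, g₁, g₂]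
  field_simp

/-- For every `d ≥ 1` there is `B₂ > 0`, depending only on `d`, such that for all
`p, q ∈ (1,∞)` with `p < q`, one has `(1/B₂)·F(p,q) ≤ Ẽ_H(p,q,d) ≤ B₂·F(p,q)`. -/
theorem EHtilde_F_comparable (d : ℕ) (hd : 1 ≤ d) :
    ∃ B₂ : ℝ, 0 < B₂ ∧ ∀ p q : ℝ, 1 < p → 1 < q → p < q →
      (1 / B₂) * Fconst p q ≤ EHtilde d p q ∧ EHtilde d p q ≤ B₂ * Fconst p q := by
  obtain ⟨m, M, hm, hbound⟩ := exists_bounds_regularFactor hd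
  have hM : 0 < M := hm.trans_le
    ((hbound 0 (by simp)).1.trans (hbound 0 (by simp)).2)
  have he := Real.exp_pos 1
  refine ⟨M * Real.exp 1 + Real.exp 1 / m, by positivity, fun p q hp hq hpq => ?_⟩
  have hp0 : 0 < p := by linarith
  have hq0 : 0 < q := by linarith
  have hp' : 0 < conjExp p := div_pos hp0 (by linarith)
  have hq' : 0 < conjExp q := div_pos hq0 (by linarith)
  have hinv : 1 / conjExp p = 1 - 1 / p := by
    have : p - 1 ≠ 0 := by linarith
    rw [conjExp]
    field_simp
  have hlt : 1 / q < 1 / p := one_div_lt_one_div_of_lt hp0 hpq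
  have hp_inv : 0 < 1 / p := by positivity
  have hq_inv : 0 < 1 / q := by positivity
  have hp'_inv : 0 < 1 / conjExp p := by positivity
  obtain ⟨s₁, s₂⟩ := inv_rpow_add_bounds hp'_inv (by linarith) hq_inv (by linarith)
  simp only [one_div, inv_inv] at s₁ s₂
  simp only [← one_div] at s₁ s₂
  obtain ⟨t, ht⟩ : ∃ t, t = 1 / conjExp p + 1 / q := ⟨_, rfl⟩
  have ht0 : 0 < t := by rw [ht]; positivity
  have ht1 : t ≤ 1 := by linarith
  rw [EHtilde_eq hd hp hq hpq ht, Fconst, ← ht]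
  rw [← ht] at s₁ s₂
  obtain ⟨r₁, r₂⟩ := hbound t ⟨ht0.le, ht1⟩
  have u₁ := exp_neg_one_le_rpow_self ht0
  have u₂ : t ^ t ≤ 1 := Real.rpow_le_one ht0.le ht1 ht0.le
  have hC : 0 < t⁻¹ * (p * conjExp q)⁻¹ := by positivity
  have hS : 0 < conjExp p ^ (1 / q) + q ^ (1 / conjExp p) := by positivity
  have hB : 1 / (M * Real.exp 1 + Real.exp 1 / m) ≤ m * Real.exp (-1) := by
    rw [Real.exp_neg, ← div_eq_mul_inv, ← one_div_div (Real.exp 1) m]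
    exact one_div_le_one_div_of_le (by positivity) (le_add_of_nonneg_left (by positivity))
  have hR : 0 < regularFactor d t := hm.trans_le r₁
  constructor
  · refine mul_le_mul (hB.trans ?_) ?_ (by positivity) (by positivity)
    · gcongr
    · gcongr
  · calc regularFactor d t * t ^ t * (t⁻¹ * (p * conjExp q)⁻¹ * (conjExp p ^ t + q ^ t))
        ≤ M * 1 * (t⁻¹ * (p * conjExp q)⁻¹ *
          (Real.exp 1 * (conjExp p ^ (1 / q) + q ^ (1 / conjExp p)))) := by gcongr
      _ = M * Real.exp 1 * (t⁻¹ * (p * conjExp q)⁻¹ *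
          (conjExp p ^ (1 / q) + q ^ (1 / conjExp p))) := by ring
      _ ≤ _ := by
        gcongr
        exact le_add_of_nonneg_right (by positivity)
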